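/- arXiv:1807.11557 — 2 statements merged into one kernel-verified Lean document; each statement's English description precedes it below -/
import Mathlib

section
/- Let α be a join-semilattice, let S be a finite subset of α, and let T be a nonempty subset of S. Then every strictly increasing chain x₁ < x₂ < ⋯ < x_k such that each x_i belongs to the join-closure of S and ⊔T ≤ x₁ has length k ≤ |S| − |T| + 1. (This is the combinatorial core of the paper's Lemma 9: after the first round-trip of LA_δ each process's value is the join of at least n − f of the n input values, so the residual sublattice has height at most f.) -/
/-- The join-closure of a finite subset `S` of a join-semilattice:
the set of all joins of nonempty subsets of `S`. -/
def joinClosure {α : Type*} [SemilatticeSup α] (S : Finset α) : Set α :=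
  {a | ∃ A : Finset α, A ⊆ S ∧ ∃ hA : A.Nonempty, a = A.sup' hA id}

/-- An element of the join-closure of `S` is determined by the elements of `S` below it. -/
theorem le_of_mem_joinClosure {α : Type*} [SemilatticeSup α] {S : Finset α} {a b : α}
    (ha : a ∈ joinClosure S) (h : ∀ s ∈ S, s ≤ a → s ≤ b) : a ≤ b := by
  obtain ⟨A, hAS, hA, rfl⟩ := ha
  exact Finset.sup'_le hA id fun s hs => h s (hAS hs) (Finset.le_sup' id hs)

open Classical in
/-- On the join-closure of `S`, the set of elements of `S` below a point is strictly monotone. -/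
theorem filter_le_ssubset_of_lt {α : Type*} [SemilatticeSup α] {S : Finset α} {a b : α}
    (hb : b ∈ joinClosure S) (hab : a < b) : S.filter (· ≤ a) ⊂ S.filter (· ≤ b) := by
  refine ⟨Finset.monotone_filter_right S fun _ _ hs => hs.trans hab.le, fun hsub => ?_⟩
  refine hab.not_ge (le_of_mem_joinClosure hb fun s hs hsb => ?_)
  exact (Finset.mem_filter.1 (hsub (Finset.mem_filter.2 ⟨hs, hsb⟩))).2

/-- Every strictly increasing chain in the join-closure of `S` whose first
element is above the join of a nonempty subset `T ⊆ S` has length at most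
`|S| - |T| + 1`. -/
theorem chain_length_le_of_join_le_first
    {α : Type*} [SemilatticeSup α] (S T : Finset α) (hTS : T ⊆ S)
    (hT : T.Nonempty)
    (k : ℕ) (x : Fin k → α) (hmono : StrictMono x)
    (hmem : ∀ i, x i ∈ joinClosure S)
    (hfirst : ∀ hk : 0 < k, T.sup' hT id ≤ x ⟨0, hk⟩) :
    k ≤ S.card - T.card + 1 := by
  classical
  have hcard : StrictMono fun i => (S.filter (· ≤ x i)).card := fun i j hij =>
    Finset.card_lt_card (filter_le_ssubset_of_lt (hmem j) (hmono hij))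
  have hmaps : ∀ i ∈ (Finset.univ : Finset (Fin k)),
      (S.filter (· ≤ x i)).card ∈ Finset.Icc T.card S.card := by
    intro i _
    refine Finset.mem_Icc.2 ⟨Finset.card_le_card fun t ht => ?_, Finset.card_filter_le _ _⟩
    have hk : 0 < k := i.pos
    have hle : x ⟨0, hk⟩ ≤ x i := hmono.monotone (Fin.mk_le_of_le_val (Nat.zero_le _))
    exact Finset.mem_filter.2
      ⟨hTS ht, (Finset.le_sup' id ht).trans ((hfirst hk).trans hle)⟩
  have hle := Finset.card_le_card_of_injOn _ hmaps hcard.injective.injOn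
  rw [Finset.card_univ, Fintype.card_fin, Nat.card_Icc] at hle
  omega
end

section
/- Let α be a join-semilattice, let G be a finite index set, let v : G → α, let k be a natural number, and let C ⊆ G (the set of correct processes). For each j ∈ G let R_j ⊆ G be a nonempty set with C ⊆ R_j (every process receives the values of all correct processes), and set w_j := ⊔{v(i) : i ∈ R_j}. Let S := {j ∈ C : height(w_j) ≤ k} (the correct processes classified as slaves) and suppose S is nonempty. Then: (i) height(⊔{v(j) : j ∈ S}) ≤ k; and (ii) for every i ∈ G with height(w_i) > k (a process classified as master), ⊔{v(j) : j ∈ S} ≤ w_i. (This is an abstraction of properties (p4) and (p5) of the paper's Lemma 1 about the Classifier procedure.) -/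
/-- Abstraction of properties (p4) and (p5) of the Classifier procedure.
Each process `j ∈ G` receives the values of the processes in `R j ⊆ G`, where
`R j` contains all correct processes `C`, and forms the join `w j`.  Let `S` be
the set of correct processes classified as slaves (`height (w j) ≤ k`).  Then
the join of the slaves' values has height at most `k`, and is below `w i` for
every master `i` (`height (w i) > k`). -/
theorem classifier_slave_properties
    {α : Type*} [SemilatticeSup α] {ι : Type*} [DecidableEq ι]
    (G : Finset ι) (v : ι → α) (k : ℕ) (C : Finset ι) (hCG : C ⊆ G)
    (R : ι → Finset ι) (hR : ∀ j ∈ G, (R j).Nonempty ∧ C ⊆ R j ∧ R j ⊆ G)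
    (w : ι → α) (hw : ∀ j ∈ G, ∀ h : (R j).Nonempty, w j = (R j).sup' h v)
    (S : Finset ι) (hS : S = C.filter (fun j => Order.height (w j) ≤ (k : ℕ∞)))
    (hSne : S.Nonempty) :
    Order.height (S.sup' hSne v) ≤ (k : ℕ∞) ∧
      ∀ i ∈ G, (k : ℕ∞) < Order.height (w i) → S.sup' hSne v ≤ w i := by
  have hSC : S ⊆ C := hS ▸ Finset.filter_subset _ _
  have hle : ∀ i ∈ G, S.sup' hSne v ≤ w i := fun i hi => by
    obtain ⟨hne, hCR, -⟩ := hR i hi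
    rw [hw i hi hne]
    exact Finset.sup'_mono v (hSC.trans hCR) hSne
  refine ⟨?_, fun i hi _ => hle i hi⟩
  obtain ⟨j, hj⟩ := hSne
  have hjk : Order.height (w j) ≤ (k : ℕ∞) := by
    rw [hS] at hj
    exact (Finset.mem_filter.mp hj).2
  exact (Order.height_mono (hle j (hCG (hSC hj)))).trans hjk
end
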